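/- Let P be a pencil of quadratic forms in n variables over a field F with #F ≥ n; write r = r(P) and R = R(P), and suppose r < R. Assume further either that the characteristic of F is not 2, or that r is even and F is the residue field of the completion of a number field at a non-archimedean place. Then one can choose a basis q_1, q_2 for P with rank(q_1) = r, and for any such basis there is an invertible change of variables over F so that q_1(X_1,...,X_n) = q_1'(X_1,...,X_r) and q_2(X_1,...,X_n) = q_2'(X_1,...,X_{R-1}) + X_r X_R for certain quadratic forms q_1', q_2' over F. -/

import Mathlib

open MvPolynomial NumberField IsDedekindDomain

/-- Substitution `q(T·X)` for a matrix `T`. -/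
noncomputable def substMat {K : Type*} [CommRing K] {n : ℕ}
    (T : Matrix (Fin n) (Fin n) K) (q : MvPolynomial (Fin n) K) : MvPolynomial (Fin n) K :=
  MvPolynomial.aeval (fun i => ∑ j, MvPolynomial.C (T i j) * MvPolynomial.X j) q

/-- `q` is a function of the variables `X_0, …, X_{m-1}` alone. -/
def DependsOnlyOnFirst {K : Type*} [CommRing K] {n : ℕ} (m : ℕ)
    (q : MvPolynomial (Fin n) K) : Prop :=
  ∀ i ∈ q.vars, (i : ℕ) < m

/-- The rank of a quadratic form: the least `m` such that an invertible linear change of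
variables makes it a function of the first `m` variables alone. -/
noncomputable def qRank {K : Type*} [Field K] {n : ℕ} (q : MvPolynomial (Fin n) K) : ℕ :=
  sInf {m | ∃ T : Matrix (Fin n) (Fin n) K, IsUnit T.det ∧ DependsOnlyOnFirst m (substMat T q)}

/-- The polynomial `X_0X_1 + X_2X_3 + ⋯ + X_{2m-2}X_{2m-1}` (a sum of `m` hyperbolic planes). -/
noncomputable def hypSum (n m : ℕ) (K : Type*) [CommRing K] : MvPolynomial (Fin n) K :=
  ∑ i ∈ Finset.range m,
    if h : 2 * i + 1 < n then
      MvPolynomial.X (⟨2 * i, by omega⟩ : Fin n) * MvPolynomial.X (⟨2 * i + 1, h⟩ : Fin n)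
    else 0

/-- A quadratic form in `n` variables splits off (at least) `m` hyperbolic planes: an invertible
change of variables puts it in the shape `X_0X_1 + ⋯ + X_{2m-2}X_{2m-1} + Q'(X_{2m},…,X_{n-1})`. -/
def SplitsOffHyperbolics {K : Type*} [Field K] {n : ℕ} (m : ℕ)
    (Q : MvPolynomial (Fin n) K) : Prop :=
  2 * m ≤ n ∧ ∃ T : Matrix (Fin n) (Fin n) K, IsUnit T.det ∧
    ∃ Q' : MvPolynomial (Fin n) K, (∀ i ∈ Q'.vars, 2 * m ≤ (i : ℕ)) ∧
      substMat T Q = hypSum n m K + Q'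

/-- The intersection of the two quadrics `Q₁ = Q₂ = 0` is nonsingular: the `2 × n` matrix of
partial derivatives has rank `2` at every nonzero point over the algebraic closure. -/
def NonsingularIntersection {K : Type*} [Field K] {n : ℕ}
    (Q₁ Q₂ : MvPolynomial (Fin n) K) : Prop :=
  ∀ x : Fin n → AlgebraicClosure K, x ≠ 0 →
    Matrix.rank (Matrix.of fun (i : Fin 2) (j : Fin n) =>
      MvPolynomial.eval x (MvPolynomial.pderiv j
        (MvPolynomial.map (algebraMap K (AlgebraicClosure K)) (if i = 0 then Q₁ else Q₂)))) = 2

/-- `r(q₁,q₂)`: the maximal rank of a nontrivial form in the pencil, over the algebraic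
closure. -/
noncomputable def pencilRmax {K : Type*} [Field K] {n : ℕ}
    (q₁ q₂ : MvPolynomial (Fin n) K) : ℕ :=
  sSup {m | ∃ a b : AlgebraicClosure K, (a ≠ 0 ∨ b ≠ 0) ∧
    m = qRank (MvPolynomial.C a * MvPolynomial.map (algebraMap K (AlgebraicClosure K)) q₁ +
      MvPolynomial.C b * MvPolynomial.map (algebraMap K (AlgebraicClosure K)) q₂)}

/-- `r_min(q₁,q₂)`: the minimal rank of a nontrivial form in the pencil, over the algebraic
closure. -/
noncomputable def pencilRmin {K : Type*} [Field K] {n : ℕ}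
    (q₁ q₂ : MvPolynomial (Fin n) K) : ℕ :=
  sInf {m | ∃ a b : AlgebraicClosure K, (a ≠ 0 ∨ b ≠ 0) ∧
    m = qRank (MvPolynomial.C a * MvPolynomial.map (algebraMap K (AlgebraicClosure K)) q₁ +
      MvPolynomial.C b * MvPolynomial.map (algebraMap K (AlgebraicClosure K)) q₂)}

/-- `R(q₁,q₂)`: the least `m` such that an invertible change of variables over `K` makes every
form in the pencil (over the algebraic closure) a function of the first `m` variables alone. -/
noncomputable def pencilR {K : Type*} [Field K] {n : ℕ}
    (q₁ q₂ : MvPolynomial (Fin n) K) : ℕ :=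
  sInf {m | ∃ T : Matrix (Fin n) (Fin n) K, IsUnit T.det ∧
    ∀ a b : AlgebraicClosure K,
      DependsOnlyOnFirst m
        (MvPolynomial.C a * MvPolynomial.map (algebraMap K (AlgebraicClosure K)) (substMat T q₁) +
         MvPolynomial.C b * MvPolynomial.map (algebraMap K (AlgebraicClosure K)) (substMat T q₂))}

/-- The symmetrized coefficient matrix `M(q)` of a quadratic form `q = ∑_{i ≤ j} q_{ij}X_iX_j`:
its `(i,j)` entry is `q_{ij}` for `i < j`, `2q_{ii}` for `i = j`, and `q_{ji}` for `i > j`. -/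
noncomputable def Mmat {K : Type*} [CommRing K] {n : ℕ}
    (q : MvPolynomial (Fin n) K) : Matrix (Fin n) (Fin n) K :=
  Matrix.of fun i j =>
    if i < j then q.coeff (Finsupp.single i 1 + Finsupp.single j 1)
    else if i = j then 2 * q.coeff (Finsupp.single i 2)
    else q.coeff (Finsupp.single j 1 + Finsupp.single i 1)

theorem finite_residueField_adicCompletionIntegers (k : Type*) [Field k] [NumberField k]
    (v : HeightOneSpectrum (𝓞 k)) :
    Finite (IsLocalRing.ResidueField (v.adicCompletionIntegers k)) := by
  have hfin : Finite (𝓞 k ⧸ v.asIdeal) := v.asIdeal.finiteQuotientOfFreeOfNeBot v.ne_bot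
  let φ : 𝓞 k →+* IsLocalRing.ResidueField (v.adicCompletionIntegers k) :=
    (IsLocalRing.residue _).comp (algebraMap (𝓞 k) (v.adicCompletionIntegers k))
  have hval : ∀ x : 𝓞 k, Valued.v ((algebraMap (𝓞 k) (v.adicCompletionIntegers k) x :
      v.adicCompletionIntegers k) : v.adicCompletion k) = v.intValuation x := fun x => by
    rw [HeightOneSpectrum.algebraMap_adicCompletionIntegers_apply,
      HeightOneSpectrum.valuedAdicCompletion_eq_valuation',
      HeightOneSpectrum.valuation_of_algebraMap]
  have hres : ∀ z : v.adicCompletionIntegers k,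
      Valued.v (z : v.adicCompletion k) < 1 → IsLocalRing.residue _ z = 0 := fun z hz => by
    rw [IsLocalRing.residue_eq_zero_iff, IsLocalRing.mem_maximalIdeal, mem_nonunits_iff,
      HeightOneSpectrum.adicCompletionIntegers.isUnit_iff_valued_eq_one]
    exact hz.ne
  have hker : ∀ x ∈ v.asIdeal, φ x = 0 := fun x hx => by
    refine hres _ ?_
    rw [hval]
    exact (v.intValuation_lt_one_iff_mem x).2 hx
  let ψ := Ideal.Quotient.lift v.asIdeal φ hker
  refine Finite.of_surjective
    (fun p : (𝓞 k ⧸ v.asIdeal) × (𝓞 k ⧸ v.asIdeal) => ψ p.1 * (ψ p.2)⁻¹) fun y => ?_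
  obtain ⟨x, rfl⟩ := IsLocalRing.residue_surjective y
  obtain ⟨z, hz⟩ : ∃ z : k, Valued.v ((x : v.adicCompletion k) -
      algebraMap k (v.adicCompletion k) z) < 1 := by
    have hopen : IsOpen {w : v.adicCompletion k | Valued.v ((x : v.adicCompletion k) - w) < 1} := by
      have h := Valued.isOpen_ball (v.adicCompletion k) 1
      have h2 := h.preimage (continuous_const.sub continuous_id :
        Continuous fun w => (x : v.adicCompletion k) - w)
      convert h2 using 1
      ext w
      simp [Valuation.restrict_lt_one_iff]
    exact (HeightOneSpectrum.denseRange_algebraMap k v).exists_mem_open hopen ⟨x, by simp⟩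
  have hz1 : v.valuation k z ≤ 1 := by
    rw [← HeightOneSpectrum.valuedAdicCompletion_eq_valuation' v z]
    have hx : Valued.v (x : v.adicCompletion k) ≤ 1 := x.2
    have := Valuation.map_sub_le (v := (Valued.v : Valuation (v.adicCompletion k) _)) hx hz.le
    rwa [sub_sub_cancel] at this
  obtain ⟨a, d, had⟩ := v.exists_primeCompl_mul_eq_of_integer z hz1
  have hd : φ d ≠ 0 := by
    have h1 := hval d
    rw [(v.intValuation_eq_one_iff_mem_primeCompl d).2 d.2,
      ← HeightOneSpectrum.adicCompletionIntegers.isUnit_iff_valued_eq_one] at h1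
    exact (h1.map (IsLocalRing.residue _)).ne_zero
  refine ⟨(Ideal.Quotient.mk _ a, Ideal.Quotient.mk _ d), ?_⟩
  change φ a * (φ d)⁻¹ = _
  rw [← div_eq_mul_inv, div_eq_iff hd, eq_comm, ← sub_eq_zero]
  change _ * IsLocalRing.residue _ (algebraMap _ _ (d : 𝓞 k)) -
    IsLocalRing.residue _ (algebraMap _ _ a) = 0
  rw [← map_mul, ← map_sub]
  refine hres _ ?_
  have : ((x * algebraMap (𝓞 k) (v.adicCompletionIntegers k) d -
      algebraMap (𝓞 k) (v.adicCompletionIntegers k) a : v.adicCompletionIntegers k) :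
      v.adicCompletion k) = ((x : v.adicCompletion k) - algebraMap k (v.adicCompletion k) z) *
        ((algebraMap (𝓞 k) (v.adicCompletionIntegers k) d : v.adicCompletionIntegers k) :
          v.adicCompletion k) := by
    have h := congrArg (algebraMap k (v.adicCompletion k)) had
    rw [map_mul] at h
    push_cast
    rw [HeightOneSpectrum.algebraMap_adicCompletionIntegers_apply,
      HeightOneSpectrum.algebraMap_adicCompletionIntegers_apply, sub_mul]
    exact congrArg _ h.symm
  rw [this, map_mul, hval, (v.intValuation_eq_one_iff_mem_primeCompl d).2 d.2, mul_one]
  exact hz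

theorem Matrix.exists_linearIndependent_submatrix_row {K m n : Type*} [Field K] [Fintype m]
    [Fintype n] (A : Matrix m n K) {r : ℕ} (hr : A.rank = r) :
    ∃ f : Fin r → m, LinearIndependent K (A.submatrix f id).row := by
  have h := A.rank_eq_finrank_span_row
  obtain ⟨b, hb, -, hli⟩ := Submodule.exists_fun_fin_finrank_span_eq K (Set.range A.row)
  choose f hf using hb
  have e : r = Module.finrank K (Submodule.span K (Set.range A.row)) := by rw [← h, hr]
  refine ⟨f ∘ Fin.cast e, ?_⟩
  have hfb : (A.submatrix (f ∘ Fin.cast e) id).row = b ∘ Fin.cast e := funext fun i => hf _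
  rw [hfb]
  exact hli.comp (Fin.cast e) (Fin.cast_injective e)

theorem Matrix.exists_submatrix_det_ne_zero {K m n : Type*} [Field K] [Fintype m] [Fintype n]
    (A : Matrix m n K) : ∃ (f : Fin A.rank → m) (g : Fin A.rank → n),
      (A.submatrix f g).det ≠ 0 := by
  obtain ⟨f, hf⟩ := A.exists_linearIndependent_submatrix_row rfl
  have h1 := hf.rank_matrix
  rw [← Matrix.rank_transpose, Fintype.card_fin] at h1
  obtain ⟨g, hg⟩ := Matrix.exists_linearIndependent_submatrix_row _ h1
  refine ⟨f, g, ?_⟩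
  rw [Matrix.linearIndependent_rows_iff_isUnit, Matrix.isUnit_iff_isUnit_det] at hg
  rw [← Matrix.det_transpose]
  exact hg.ne_zero

theorem LinearMap.even_finrank_sub_ker_of_alt {K V : Type*} [Field K] [AddCommGroup V] [Module K V]
    [FiniteDimensional K V] (B : V →ₗ[K] V →ₗ[K] K) (hB : ∀ x, B x x = 0) :
    Even (Module.finrank K V - Module.finrank K (LinearMap.ker B)) := by
  induction hn : Module.finrank K V using Nat.strong_induction_on generalizing V with
  | _ n ih =>
  by_cases h0 : B = 0
  · subst h0
    rw [LinearMap.ker_zero, finrank_top, hn]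
    simp
  obtain ⟨x, y, hxy⟩ : ∃ x y, B x y ≠ 0 := by
    by_contra! h
    exact h0 (LinearMap.ext fun x => LinearMap.ext fun y => h x y)
  have hskew : ∀ u w, B u w = - B w u := fun u w => by
    have := hB (u + w)
    simp only [map_add, LinearMap.add_apply, hB] at this
    linear_combination this
  let f : V →ₗ[K] K × K := (B x).prod (B y)
  have hf : Function.Surjective f := by
    rintro ⟨a, b⟩
    refine ⟨(a * (B x y)⁻¹) • y - (b * (B x y)⁻¹) • x, ?_⟩
    have h1 := hskew y x
    simp [f, hB, h1, hxy]
  let W := LinearMap.ker f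
  have hW : ∀ w ∈ W, B x w = 0 ∧ B y w = 0 := fun w hw => by
    simpa [W, f] using hw
  have hdim : _ + Module.finrank K W = _ := f.finrank_range_add_finrank_ker
  rw [LinearMap.range_eq_top.2 hf, finrank_top, Module.finrank_prod, Module.finrank_self] at hdim
  let BW : W →ₗ[K] W →ₗ[K] K := B.domRestrict₁₂ W W
  have hBW : ∀ u w : W, BW u w = B u w := fun _ _ => rfl
  have key : Module.finrank K (LinearMap.ker BW) = Module.finrank K (LinearMap.ker B) := by
    have : (LinearMap.ker BW).map W.subtype = LinearMap.ker B := by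
      ext v
      constructor
      · rintro ⟨⟨w, hw⟩, hwk, rfl⟩
        have hwk' : BW ⟨w, hw⟩ = 0 := hwk
        rw [LinearMap.mem_ker]
        ext u
        obtain ⟨hx, hy⟩ := hW w hw
        have hu : u - (B x u * (B x y)⁻¹) • y + (B y u * (B x y)⁻¹) • x ∈ W := by
          have h1 := hskew y x
          simp [W, f, hB, h1, hxy]
        have := LinearMap.congr_fun hwk' ⟨_, hu⟩
        simpa [hBW, hskew w x, hskew w y, hx, hy] using this
      · intro hv
        rw [LinearMap.mem_ker] at hv
        have hvW : v ∈ W := by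
          simp [W, f, hskew _ v, hv]
        refine ⟨⟨v, hvW⟩, ?_, rfl⟩
        ext u
        simp [hBW, hv]
    rw [← this]
    exact (LinearEquiv.finrank_eq (Submodule.equivMapOfInjective _ W.injective_subtype _))
  have := ih (Module.finrank K W) (by omega) BW (fun w => hB w) rfl
  rw [key] at this
  have hle : Module.finrank K (LinearMap.ker B) ≤ Module.finrank K W := by
    rw [← key]; exact Submodule.finrank_le _
  rw [← hn, ← hdim]
  change Even (1 + 1 + Module.finrank K W - _)
  rw [Nat.add_sub_assoc hle]
  exact Even.add ⟨1, rfl⟩ this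

section QuadPoly

variable {K : Type*} [CommRing K] {n : ℕ}

/-- The quadratic form `∑ i j, G i j X_i X_j` attached to a (not necessarily symmetric) matrix. -/
noncomputable def quadPoly (G : Matrix (Fin n) (Fin n) K) : MvPolynomial (Fin n) K :=
  ∑ i, ∑ j, C (G i j) * (X i * X j)

theorem quadPoly_add (G H : Matrix (Fin n) (Fin n) K) :
    quadPoly (G + H) = quadPoly G + quadPoly H := by
  simp [quadPoly, add_mul, Finset.sum_add_distrib]

theorem quadPoly_smul (a : K) (G : Matrix (Fin n) (Fin n) K) :
    quadPoly (a • G) = C a * quadPoly G := by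
  simp [quadPoly, mul_assoc, Finset.mul_sum]

theorem quadPoly_single (i j : Fin n) (a : K) :
    quadPoly (Matrix.single i j a) = C a * (X i * X j) := by
  rw [quadPoly, Finset.sum_eq_single i, Finset.sum_eq_single j]
  · simp
  · intro b _ hb
    simp [hb.symm]
  · simp
  · intro b _ hb
    simp [hb.symm]
  · simp

theorem map_quadPoly {L : Type*} [CommRing L] (f : K →+* L) (G : Matrix (Fin n) (Fin n) K) :
    MvPolynomial.map f (quadPoly G) = quadPoly (G.map f) := by
  simp [quadPoly]

theorem substMat_quadPoly (T G : Matrix (Fin n) (Fin n) K) :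
    substMat T (quadPoly G) = quadPoly (T.transpose * G * T) := by
  have h : ∀ i j, aeval (fun i => ∑ j, C (T i j) * X j) (C (G i j) * (X i * X j)) =
      ∑ a, ∑ b, C (T i a * G i j * T j b) * (X a * X b : MvPolynomial (Fin n) K) := by
    intro i j
    rw [map_mul, map_mul, aeval_C, aeval_X, aeval_X, algebraMap_eq, Finset.sum_mul_sum,
      Finset.mul_sum]
    refine Finset.sum_congr rfl fun a _ => ?_
    rw [Finset.mul_sum]
    refine Finset.sum_congr rfl fun b _ => ?_
    rw [map_mul, map_mul]
    ring
  simp only [substMat, quadPoly, map_sum, h, Matrix.mul_apply, Matrix.transpose_apply,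
    Finset.sum_mul]
  calc _ = ∑ i, ∑ a, ∑ j, ∑ b, C (T i a * G i j * T j b) * (X a * X b) :=
        Finset.sum_congr rfl fun _ _ => Finset.sum_comm
    _ = ∑ a, ∑ i, ∑ j, ∑ b, C (T i a * G i j * T j b) * (X a * X b) := Finset.sum_comm
    _ = ∑ a, ∑ i, ∑ b, ∑ j, C (T i a * G i j * T j b) * (X a * X b) :=
        Finset.sum_congr rfl fun _ _ => Finset.sum_congr rfl fun _ _ => Finset.sum_comm
    _ = ∑ a, ∑ b, ∑ i, ∑ j, C (T i a * G i j * T j b) * (X a * X b) :=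
        Finset.sum_congr rfl fun _ _ => Finset.sum_comm
    _ = _ := Finset.sum_congr rfl fun _ _ => Finset.sum_congr rfl fun _ _ => Finset.sum_comm

theorem coeff_quadPoly (G : Matrix (Fin n) (Fin n) K) (i j : Fin n) :
    (quadPoly G).coeff (Finsupp.single i 1 + Finsupp.single j 1) =
      ∑ a, ∑ b, if (a = i ∧ b = j) ∨ (a = j ∧ b = i) then G a b else 0 := by
  simp only [quadPoly, coeff_sum]
  refine Finset.sum_congr rfl fun a _ => Finset.sum_congr rfl fun b _ => ?_
  rw [X, X, monomial_mul, C_mul_monomial, coeff_monomial]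
  simp [Finsupp.single_add_single_eq_single_add_single]

theorem coeff_quadPoly_self (G : Matrix (Fin n) (Fin n) K) (i : Fin n) :
    (quadPoly G).coeff (Finsupp.single i 1 + Finsupp.single i 1) = G i i := by
  simp [coeff_quadPoly, ite_and]

theorem coeff_quadPoly_of_ne (G : Matrix (Fin n) (Fin n) K) {i j : Fin n} (hij : i ≠ j) :
    (quadPoly G).coeff (Finsupp.single i 1 + Finsupp.single j 1) = G i j + G j i := by
  have h : ∀ a b, (if (a = i ∧ b = j) ∨ (a = j ∧ b = i) then G a b else 0) =
      (if a = i then if b = j then G a b else 0 else 0) +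
        if a = j then if b = i then G a b else 0 else 0 := by
    intro a b
    grind
  simp [coeff_quadPoly, h, Finset.sum_add_distrib]

theorem exists_eq_quadPoly {q : MvPolynomial (Fin n) K} (hq : q.IsHomogeneous 2) :
    ∃ G : Matrix (Fin n) (Fin n) K, q = quadPoly G := by
  have hs : ∀ s : Finset (Fin n →₀ ℕ), (∀ d ∈ s, d.degree = 2) →
      ∃ G : Matrix (Fin n) (Fin n) K, ∑ d ∈ s, monomial d (q.coeff d) = quadPoly G := by
    intro s
    induction s using Finset.induction_on with
    | empty => exact fun _ => ⟨0, by simp [quadPoly]⟩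
    | insert d s hd ih =>
      intro h
      obtain ⟨G, hG⟩ := ih fun d hd => h d (Finset.mem_insert_of_mem hd)
      have h2 := h d (Finset.mem_insert_self _ _)
      have hc : (Finsupp.toMultiset d).card = 2 := by
        rw [Finsupp.card_toMultiset]
        exact h2
      obtain ⟨i, j, hij⟩ := Multiset.card_eq_two.1 hc
      have hdij : d = Finsupp.single i 1 + Finsupp.single j 1 := by
        apply Multiset.toFinsupp.symm.injective
        change Finsupp.toMultiset d = Finsupp.toMultiset _
        rw [hij]
        simp
      refine ⟨Matrix.single i j (q.coeff d) + G, ?_⟩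
      rw [Finset.sum_insert hd, hG, quadPoly_add, quadPoly_single]
      congr 1
      rw [hdij, X, X, monomial_mul, C_mul_monomial]
      simp
  obtain ⟨G, hG⟩ := hs q.support fun d hd => by
    have := hq (mem_support_iff.1 hd)
    rwa [Finsupp.degree_eq_weight_one]
  exact ⟨G, by rw [← hG, ← q.as_sum]⟩

theorem dependsOnlyOnFirst_quadPoly_iff {m : ℕ} (G : Matrix (Fin n) (Fin n) K) :
    DependsOnlyOnFirst m (quadPoly G) ↔
      ∀ i : Fin n, m ≤ i → G i i = 0 ∧ ∀ j, (G + G.transpose) i j = 0 := by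
  constructor
  · intro h i hi
    have h0 : ∀ j, (quadPoly G).coeff (Finsupp.single i 1 + Finsupp.single j 1) = 0 := by
      intro j
      by_contra hne
      have : i ∈ (quadPoly G).vars := by
        rw [mem_vars_iff_mem_support]
        exact ⟨_, mem_support_iff.2 hne, by simp⟩
      exact absurd (h i this) (not_lt.2 hi)
    have hii : G i i = 0 := by rw [← coeff_quadPoly_self G, h0]
    refine ⟨hii, fun j => ?_⟩
    by_cases hij : i = j
    · subst hij
      simp [hii]
    · rw [Matrix.add_apply, Matrix.transpose_apply, ← coeff_quadPoly_of_ne G hij, h0]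
  · intro h i hi
    by_contra hm
    obtain ⟨hii, hij⟩ := h i (not_lt.1 hm)
    obtain ⟨d, hd, hid⟩ := (mem_vars_iff_mem_support i).1 hi
    obtain ⟨a, -, hda⟩ := Finset.mem_biUnion.1 (support_sum hd)
    obtain ⟨b, -, hdb⟩ := Finset.mem_biUnion.1 (support_sum hda)
    have hd' : d = Finsupp.single a 1 + Finsupp.single b 1 := by
      have := hdb
      rw [X, X, monomial_mul, C_mul_monomial] at this
      simpa using support_monomial_subset this
    rw [mem_support_iff] at hd
    have hab : i = a ∨ i = b := by
      by_contra! hne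
      rw [hd'] at hid
      simp [hne.1.symm, hne.2.symm] at hid
    apply hd
    have key : ∀ j, (quadPoly G).coeff (Finsupp.single i 1 + Finsupp.single j 1) = 0 := by
      intro j
      by_cases e : i = j
      · subst e
        rw [coeff_quadPoly_self, hii]
      · rw [coeff_quadPoly_of_ne G e]
        exact hij j
    rcases hab with rfl | rfl
    · rw [hd', key]
    · rw [hd', add_comm, key]

end QuadPoly

section Flags

open Module

variable {K V : Type*} [Field K] [AddCommGroup V] [Module K V]

theorem exists_linearIndependent_mem_submodules [FiniteDimensional K V] :
    ∀ {m : ℕ} (W : Fin m → Submodule K V), (∀ i, m - i ≤ finrank K (W i)) →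
      ∃ b : Fin m → V, LinearIndependent K b ∧ ∀ i, b i ∈ W i
  | 0, _, _ => ⟨Fin.elim0, linearIndependent_empty_type, fun i => i.elim0⟩
  | m + 1, W, h => by
    obtain ⟨b, hb, hbW⟩ := exists_linearIndependent_mem_submodules (fun i => W (Fin.succ i))
      fun i => by simpa using h i.succ
    obtain ⟨x, hx, hxb⟩ : ∃ x ∈ W 0, x ∉ Submodule.span K (Set.range b) := by
      by_contra! hle
      have h1 := Submodule.finrank_mono (show W 0 ≤ _ from hle)
      rw [finrank_span_eq_card hb, Fintype.card_fin] at h1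
      have h2 := h 0
      simp only [Fin.val_zero] at h2
      omega
    exact ⟨Fin.cons x b, linearIndependent_finCons.2 ⟨hb, hxb⟩, Fin.cases hx hbW⟩

theorem LinearIndependent.sub_le_finrank [FiniteDimensional K V] {n m : ℕ} {b : Fin n → V}
    (hb : LinearIndependent K b) {U : Submodule K V} (h : ∀ i : Fin n, m ≤ i → b i ∈ U) :
    n - m ≤ finrank K U := by
  let f : Fin (n - m) → Fin n := fun j => ⟨m + j, by omega⟩
  have hf : Function.Injective f := fun i j hij => by simpa [f, Fin.ext_iff] using hij
  have hli := hb.comp f hf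
  have hspan : Submodule.span K (Set.range (b ∘ f)) ≤ U := by
    rw [Submodule.span_le]
    rintro _ ⟨j, rfl⟩
    exact h _ (Nat.le_add_right _ _)
  have := Submodule.finrank_mono hspan
  rwa [finrank_span_eq_card hli, Fintype.card_fin] at this

theorem sInf_isUnit_det_col_mem {n : ℕ} (U : Submodule K (Fin n → K)) :
    sInf {m : ℕ | ∃ T : Matrix (Fin n) (Fin n) K, IsUnit T.det ∧ ∀ i : Fin n, m ≤ i → T.col i ∈ U} =
      n - finrank K U := by
  apply le_antisymm
  · apply Nat.sInf_le
    obtain ⟨b, hb, hbU⟩ := exists_linearIndependent_mem_submodules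
      (fun i : Fin n => if n - finrank K U ≤ i then U else ⊤) fun i => by
        by_cases h : n - finrank K U ≤ i
        · rw [if_pos h]
          omega
        · rw [if_neg h, finrank_top, finrank_fin_fun]
          omega
    refine ⟨(Matrix.of b).transpose, ?_, fun i hi => ?_⟩
    · rw [← Matrix.isUnit_iff_isUnit_det, ← Matrix.linearIndependent_cols_iff_isUnit]
      exact hb
    · have := hbU i
      rwa [if_pos hi] at this
  · refine le_csInf ⟨n, 1, by simp, fun i hi => absurd i.2 (not_lt.2 hi)⟩ ?_
    rintro m ⟨T, hT, h⟩
    rw [← Matrix.isUnit_iff_isUnit_det, ← Matrix.linearIndependent_cols_iff_isUnit] at hT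
    have := hT.sub_le_finrank h
    omega

end Flags

section Radical

open Module Matrix

theorem dotProduct_mulVec_add_self {A ι : Type*} [CommRing A] [Fintype ι] (G : Matrix ι ι A)
    (x y : ι → A) :
    (x + y) ⬝ᵥ G *ᵥ (x + y) = x ⬝ᵥ G *ᵥ x + y ⬝ᵥ G *ᵥ y + x ⬝ᵥ (G + Gᵀ) *ᵥ y := by
  rw [mulVec_add, dotProduct_add, add_dotProduct, add_dotProduct, add_mulVec, dotProduct_add,
    mulVec_transpose, dotProduct_comm x (y ᵥ* G), ← dotProduct_mulVec]
  ring

theorem dotProduct_mulVec_smul_self {A ι : Type*} [CommRing A] [Fintype ι] (G : Matrix ι ι A)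
    (c : A) (x : ι → A) : (c • x) ⬝ᵥ G *ᵥ (c • x) = c ^ 2 * (x ⬝ᵥ G *ᵥ x) := by
  rw [mulVec_smul, dotProduct_smul, smul_dotProduct, smul_eq_mul, smul_eq_mul]
  ring

theorem map_dotProduct_mulVec {A B ι : Type*} [CommRing A] [CommRing B] [Fintype ι] (f : A →+* B)
    (G : Matrix ι ι A) (x y : ι → A) :
    f (x ⬝ᵥ G *ᵥ y) = (f ∘ x) ⬝ᵥ G.map f *ᵥ (f ∘ y) := by
  rw [RingHom.map_dotProduct]
  congr 1
  funext i
  rw [Function.comp_apply, RingHom.map_mulVec]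

variable {K : Type*} [Field K] {n : ℕ}

/-- The radical of the quadratic form `x ↦ xᵀ G x`: the singular vectors of the radical of its
polar form. -/
def quadRadical (G : Matrix (Fin n) (Fin n) K) : Submodule K (Fin n → K) where
  carrier := {x | (G + Gᵀ) *ᵥ x = 0 ∧ x ⬝ᵥ G *ᵥ x = 0}
  zero_mem' := by simp
  add_mem' := by
    rintro x y ⟨hx, hx'⟩ ⟨hy, hy'⟩
    refine ⟨by rw [mulVec_add, hx, hy, add_zero], ?_⟩
    rw [dotProduct_mulVec_add_self, hx', hy', hy]
    simp
  smul_mem' := by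
    rintro c x ⟨hx, hx'⟩
    exact ⟨by rw [mulVec_smul, hx, smul_zero], by rw [dotProduct_mulVec_smul_self, hx', mul_zero]⟩

theorem mem_quadRadical {G : Matrix (Fin n) (Fin n) K} {x : Fin n → K} :
    x ∈ quadRadical G ↔ (G + Gᵀ) *ᵥ x = 0 ∧ x ⬝ᵥ G *ᵥ x = 0 := Iff.rfl

theorem quadRadical_le_ker (G : Matrix (Fin n) (Fin n) K) :
    quadRadical G ≤ LinearMap.ker (G + Gᵀ).mulVecLin := fun _ hx => hx.1

theorem transpose_mul_mul_apply (T G : Matrix (Fin n) (Fin n) K) (i j : Fin n) :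
    (Tᵀ * G * T) i j = T.col i ⬝ᵥ G *ᵥ T.col j := by
  rw [Matrix.mul_assoc]
  rfl

theorem add_transpose_congr (T G : Matrix (Fin n) (Fin n) K) :
    Tᵀ * G * T + (Tᵀ * G * T)ᵀ = Tᵀ * (G + Gᵀ) * T := by
  simp [Matrix.mul_add, Matrix.add_mul, Matrix.mul_assoc]

theorem dependsOnlyOnFirst_substMat_quadPoly_iff {m : ℕ} {T : Matrix (Fin n) (Fin n) K}
    (hT : IsUnit T.det) (G : Matrix (Fin n) (Fin n) K) :
    DependsOnlyOnFirst m (substMat T (quadPoly G)) ↔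
      ∀ i : Fin n, m ≤ i → T.col i ∈ quadRadical G := by
  rw [substMat_quadPoly, dependsOnlyOnFirst_quadPoly_iff]
  refine forall₂_congr fun i _ => ?_
  rw [add_transpose_congr, transpose_mul_mul_apply, and_comm, mem_quadRadical]
  refine and_congr_left fun _ => ?_
  have hsymm : (Tᵀ * (G + Gᵀ) * T)ᵀ = Tᵀ * (G + Gᵀ) * T := by
    simp [Matrix.mul_assoc, add_comm]
  have h1 : ∀ j, (Tᵀ * (G + Gᵀ) * T) i j = (Tᵀ *ᵥ ((G + Gᵀ) *ᵥ T.col i)) j := fun j => by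
    rw [← hsymm, transpose_apply, transpose_mul_mul_apply]
    rfl
  simp only [h1]
  constructor
  · intro h
    exact mulVec_injective_of_isUnit ((isUnit_iff_isUnit_det _).2 (by rwa [det_transpose]))
      ((funext h).trans (mulVec_zero _).symm)
  · intro h j
    simp [h]

theorem qRank_quadPoly (G : Matrix (Fin n) (Fin n) K) :
    qRank (quadPoly G) = n - finrank K (quadRadical G) := by
  rw [← sInf_isUnit_det_col_mem, qRank]
  congr 1
  refine Set.ext fun m => ?_
  exact exists_congr fun T => and_congr_right fun hT =>
    dependsOnlyOnFirst_substMat_quadPoly_iff hT G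

theorem dependsOnlyOnFirst_map_iff {L : Type*} [Field L] (f : K →+* L) {m : ℕ}
    (G : Matrix (Fin n) (Fin n) K) :
    DependsOnlyOnFirst m (quadPoly (G.map f)) ↔ DependsOnlyOnFirst m (quadPoly G) := by
  simp only [dependsOnlyOnFirst_quadPoly_iff, Matrix.add_apply, transpose_apply, map_apply,
    ← map_add, _root_.map_eq_zero]

theorem pencilR_quadPoly (G₁ G₂ : Matrix (Fin n) (Fin n) K) :
    pencilR (quadPoly G₁) (quadPoly G₂) =
      n - finrank K (quadRadical G₁ ⊓ quadRadical G₂ : Submodule K (Fin n → K)) := by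
  rw [← sInf_isUnit_det_col_mem, pencilR]
  congr 1
  refine Set.ext fun m => ?_
  refine exists_congr fun T => and_congr_right fun hT => ?_
  simp only [Submodule.mem_inf, imp_and, forall_and]
  rw [← dependsOnlyOnFirst_substMat_quadPoly_iff hT, ← dependsOnlyOnFirst_substMat_quadPoly_iff hT]
  simp only [substMat_quadPoly, map_quadPoly, ← quadPoly_smul, ← quadPoly_add]
  constructor
  · intro h
    rw [← dependsOnlyOnFirst_map_iff (algebraMap K (AlgebraicClosure K)),
      ← dependsOnlyOnFirst_map_iff (algebraMap K (AlgebraicClosure K)) (_ * G₂ * _)]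
    exact ⟨by simpa using h 1 0, by simpa using h 0 1⟩
  · rintro ⟨h₁, h₂⟩ a b
    rw [← dependsOnlyOnFirst_map_iff (algebraMap K (AlgebraicClosure K)),
      dependsOnlyOnFirst_quadPoly_iff] at h₁ h₂
    rw [dependsOnlyOnFirst_quadPoly_iff]
    intro i hi
    obtain ⟨h₁, h₁'⟩ := h₁ i hi
    obtain ⟨h₂, h₂'⟩ := h₂ i hi
    refine ⟨by rw [Matrix.add_apply, Matrix.smul_apply, Matrix.smul_apply, h₁, h₂]; simp,
      fun j => ?_⟩
    have e₁ := h₁' j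
    have e₂ := h₂' j
    simp only [Matrix.add_apply, transpose_apply, Matrix.smul_apply, smul_eq_mul] at e₁ e₂ ⊢
    linear_combination a * e₁ + b * e₂

end Radical

section RadicalKernel

open Module Matrix

variable {K : Type*} [Field K] {n : ℕ}

theorem two_mul_dotProduct_mulVec_self (G : Matrix (Fin n) (Fin n) K) (x : Fin n → K) :
    2 * (x ⬝ᵥ G *ᵥ x) = x ⬝ᵥ (G + Gᵀ) *ᵥ x := by
  have h := dotProduct_mulVec_add_self G x x
  rw [← two_smul K x, dotProduct_mulVec_smul_self] at h
  linear_combination h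

theorem even_sub_finrank_ker_add_transpose (h2 : (2 : K) = 0) (G : Matrix (Fin n) (Fin n) K) :
    Even (n - finrank K (LinearMap.ker (G + Gᵀ).mulVecLin)) := by
  let B : (Fin n → K) →ₗ[K] (Fin n → K) →ₗ[K] K := Matrix.toLinearMap₂' K (G + Gᵀ)
  have h := B.even_finrank_sub_ker_of_alt fun x => by
    rw [Matrix.toLinearMap₂'_apply', ← two_mul_dotProduct_mulVec_self, h2, zero_mul]
  have hker : LinearMap.ker B = LinearMap.ker (G + Gᵀ).mulVecLin := by
    ext x
    rw [LinearMap.mem_ker, LinearMap.mem_ker, mulVecLin_apply]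
    have hx : ∀ y, B x y = ((G + Gᵀ) *ᵥ x) ⬝ᵥ y := fun y => by
      rw [Matrix.toLinearMap₂'_apply', dotProduct_mulVec, ← mulVec_transpose]
      simp [add_comm]
    constructor
    · intro h
      exact dotProduct_eq_zero _ fun y => by rw [← hx, h, LinearMap.zero_apply]
    · intro h
      ext y
      simp [hx, h]
  rwa [hker, finrank_fin_fun] at h

theorem quadRadical_eq_ker (G : Matrix (Fin n) (Fin n) K)
    (h : (2 : K) ≠ 0 ∨ Even (n - finrank K (quadRadical G)) ∧ ∀ x : K, ∃ y, y ^ 2 = x) :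
    quadRadical G = LinearMap.ker (G + Gᵀ).mulVecLin := by
  refine le_antisymm (quadRadical_le_ker G) ?_
  by_cases h2 : (2 : K) = 0
  · obtain ⟨heven, hsq⟩ := h.resolve_left fun h => h h2
    by_contra hle
    obtain ⟨w, hw, hwG⟩ := SetLike.not_le_iff_exists.1 hle
    have hQw : w ⬝ᵥ G *ᵥ w ≠ 0 := fun h0 => hwG ⟨hw, h0⟩
    have hker : LinearMap.ker (G + Gᵀ).mulVecLin ≤ quadRadical G ⊔ Submodule.span K {w} := by
      intro x hx
      obtain ⟨c, hc⟩ := hsq ((x ⬝ᵥ G *ᵥ x) / (w ⬝ᵥ G *ᵥ w))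
      rw [eq_div_iff hQw] at hc
      have hcw : c • w ∈ LinearMap.ker (G + Gᵀ).mulVecLin := Submodule.smul_mem _ c hw
      have hmem : x + c • w ∈ quadRadical G := by
        refine ⟨Submodule.add_mem _ hx hcw, ?_⟩
        rw [dotProduct_mulVec_add_self, dotProduct_mulVec_smul_self, hc,
          show (G + Gᵀ) *ᵥ (c • w) = 0 from hcw, dotProduct_zero]
        linear_combination (x ⬝ᵥ G *ᵥ x) * h2
      rw [Submodule.mem_sup]
      exact ⟨_, hmem, -(c • w), Submodule.neg_mem _
        (Submodule.smul_mem _ _ (Submodule.mem_span_singleton_self w)), by simp⟩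
    have h1 := (Submodule.finrank_mono hker).trans
      (Submodule.finrank_add_le_finrank_add_finrank _ _)
    have h3 := finrank_span_singleton (K := K) (v := w) fun h0 => hQw (by simp [h0])
    have h4 := Submodule.finrank_lt_finrank_of_lt ((quadRadical_le_ker G).lt_of_not_ge hle)
    have h5 := even_sub_finrank_ker_add_transpose h2 G
    have h6 := (LinearMap.ker (G + Gᵀ).mulVecLin).finrank_le
    rw [finrank_fin_fun] at h6
    rw [Nat.even_iff] at heven h5
    omega
  · intro x hx
    refine ⟨hx, ?_⟩
    have := two_mul_dotProduct_mulVec_self G x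
    rw [show (G + Gᵀ) *ᵥ x = 0 from hx, dotProduct_zero] at this
    exact (mul_eq_zero.1 this).resolve_left h2

theorem Matrix.exists_mul_mul_eq_self {m : Type*} [Fintype m] [DecidableEq m] (S : Matrix m m K) :
    ∃ L : Matrix m m K, S * L * S = S := by
  obtain ⟨g, hg⟩ := S.mulVecLin.rangeRestrict.exists_rightInverse_of_surjective
    S.mulVecLin.range_rangeRestrict
  obtain ⟨L, hL⟩ := g.exists_extend
  refine ⟨LinearMap.toMatrix' L, ?_⟩
  apply Matrix.mulVec_injective
  funext x
  have h1 : L (S *ᵥ x) = g (S.mulVecLin.rangeRestrict x) :=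
    LinearMap.congr_fun hL (S.mulVecLin.rangeRestrict x)
  have h2 := congrArg Subtype.val (LinearMap.congr_fun hg (S.mulVecLin.rangeRestrict x))
  rw [← mulVec_mulVec, ← mulVec_mulVec, LinearMap.toMatrix'_mulVec, h1]
  exact h2

theorem dotProduct_mulVec_adjugate_eq_zero {G₁ G₂ L : Matrix (Fin n) (Fin n) K}
    (hL : (G₁ + G₁ᵀ) * L * (G₁ + G₁ᵀ) = G₁ + G₁ᵀ) {s : K}
    (hle : finrank K (LinearMap.ker (G₁ + G₁ᵀ).mulVecLin) ≤ finrank K (quadRadical (G₁ + s • G₂)))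
    (hdet : (1 + s • (L * (G₂ + G₂ᵀ))).det ≠ 0) {y : Fin n → K} (hy : (G₁ + G₁ᵀ) *ᵥ y = 0) :
    ((1 + s • (L * (G₂ + G₂ᵀ))).adjugate *ᵥ y) ⬝ᵥ
      (G₁ + s • G₂) *ᵥ ((1 + s • (L * (G₂ + G₂ᵀ))).adjugate *ᵥ y) = 0 := by
  set N := 1 + s • (L * (G₂ + G₂ᵀ)) with hN
  have hNz : ∀ z ∈ quadRadical (G₁ + s • G₂), N *ᵥ z = z - L *ᵥ ((G₁ + G₁ᵀ) *ᵥ z) := by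
    intro z hz
    have h := congrArg (L *ᵥ ·) hz.1
    simp only [transpose_add, transpose_smul, add_mulVec, mulVec_add, smul_mulVec, mulVec_smul,
      mulVec_zero] at h
    simp only [hN, add_mulVec, one_mulVec, smul_mulVec, ← mulVec_mulVec, mulVec_add, smul_add]
    rw [eq_sub_iff_add_eq, add_assoc, ← sub_eq_zero, ← h]
    abel
  let f : quadRadical (G₁ + s • G₂) →ₗ[K] LinearMap.ker (G₁ + G₁ᵀ).mulVecLin :=
    (N.mulVecLin.domRestrict _).codRestrict _ fun z => by
      rw [LinearMap.domRestrict_apply, mulVecLin_apply, hNz _ z.2, LinearMap.mem_ker,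
        mulVecLin_apply, mulVec_sub, mulVec_mulVec, mulVec_mulVec, hL, sub_self]
  have hf : Function.Injective f := fun a b hab => by
    have h : N *ᵥ (a : Fin n → K) = N *ᵥ (b : Fin n → K) := congrArg Subtype.val hab
    exact Subtype.ext (mulVec_injective_of_isUnit
      ((isUnit_iff_isUnit_det _).2 (isUnit_iff_ne_zero.2 hdet)) h)
  have hsurj : Function.Surjective f := by
    rw [← LinearMap.injective_iff_surjective_of_finrank_eq_finrank]
    · exact hf
    · exact le_antisymm (LinearMap.finrank_le_finrank_of_injective hf) hle
  obtain ⟨z, hz⟩ := hsurj ⟨y, hy⟩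
  have hzy : N *ᵥ (z : Fin n → K) = y := congrArg Subtype.val hz
  rw [← hzy, mulVec_mulVec, adjugate_mul, smul_mulVec, one_mulVec, dotProduct_mulVec_smul_self,
    z.2.2, mul_zero]

theorem dotProduct_mulVec_eq_zero_of_finrank_le [Infinite K] {G₁ G₂ : Matrix (Fin n) (Fin n) K}
    (hle : ∀ s : K, finrank K (LinearMap.ker (G₁ + G₁ᵀ).mulVecLin) ≤
      finrank K (quadRadical (G₁ + s • G₂)))
    {y : Fin n → K} (hy : y ∈ quadRadical G₁) : y ⬝ᵥ G₂ *ᵥ y = 0 := by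
  obtain ⟨L, hL⟩ := (G₁ + G₁ᵀ).exists_mul_mul_eq_self
  let ι : K →+* Polynomial K := Polynomial.C
  let N : Matrix (Fin n) (Fin n) (Polynomial K) :=
    1 + (Polynomial.X : Polynomial K) • (L * (G₂ + G₂ᵀ)).map ι
  let Z := N.adjugate *ᵥ (ι ∘ y)
  have hNs : ∀ s, N.map (Polynomial.evalRingHom s) = 1 + s • (L * (G₂ + G₂ᵀ)) := fun s => by
    ext i j
    change ((1 : Matrix (Fin n) (Fin n) (Polynomial K)) i j +
      Polynomial.X * ι ((L * (G₂ + G₂ᵀ)) i j)).eval s = (1 : Matrix (Fin n) (Fin n) K) i j +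
        s * (L * (G₂ + G₂ᵀ)) i j
    by_cases hij : i = j <;> simp [ι, hij, Matrix.one_apply, mul_comm s]
  have hZs : ∀ s, Polynomial.evalRingHom s ∘ Z = (1 + s • (L * (G₂ + G₂ᵀ))).adjugate *ᵥ y := by
    intro s
    have h : N.adjugate.map (Polynomial.evalRingHom s) =
        (N.map (Polynomial.evalRingHom s)).adjugate :=
      RingHom.map_adjugate (Polynomial.evalRingHom s) N
    funext i
    rw [Function.comp_apply, RingHom.map_mulVec, h, hNs]
    congr 2
    funext j
    simp [ι]
  have hdets : ∀ s, N.det.eval s = (1 + s • (L * (G₂ + G₂ᵀ))).det := fun s => by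
    rw [← hNs]
    exact RingHom.map_det (Polynomial.evalRingHom s) N
  have hdet : N.det ≠ 0 := fun h => by
    have := hdets 0
    simp [h] at this
  have hF : Z ⬝ᵥ (G₁.map ι + (Polynomial.X : Polynomial K) • G₂.map ι) *ᵥ Z = 0 := by
    refine (mul_eq_zero.1 (Polynomial.funext fun s => ?_)).resolve_right hdet
    rw [Polynomial.eval_mul, Polynomial.eval_zero, hdets]
    by_cases hs : (1 + s • (L * (G₂ + G₂ᵀ))).det = 0
    · rw [hs, mul_zero]
    have h := dotProduct_mulVec_adjugate_eq_zero hL (hle s) hs hy.1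
    have hG : (G₁.map ι + (Polynomial.X : Polynomial K) • G₂.map ι).map (Polynomial.evalRingHom s) =
        G₁ + s • G₂ := by
      ext i j
      simp [ι, mul_comm s]
    have he : (Z ⬝ᵥ (G₁.map ι + (Polynomial.X : Polynomial K) • G₂.map ι) *ᵥ Z).eval s = 0 := by
      rw [← h, ← Polynomial.coe_evalRingHom, map_dotProduct_mulVec, hG, hZs]
    rw [he, zero_mul]
  obtain ⟨W, hW⟩ : ∃ W : Fin n → Polynomial K, Z = ι ∘ y + (Polynomial.X : Polynomial K) • W := by
    have : ∀ i, (Polynomial.X : Polynomial K) ∣ Z i - ι (y i) := fun i => by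
      rw [Polynomial.X_dvd_iff, Polynomial.coeff_zero_eq_eval_zero]
      have := congrFun (hZs 0) i
      simp only [Function.comp_apply, Polynomial.coe_evalRingHom, zero_smul, add_zero, adjugate_one,
        one_mulVec] at this
      simp [ι, this]
    choose W hW using this
    exact ⟨W, funext fun i => by simp [← hW]⟩
  have hι : ∀ G : Matrix (Fin n) (Fin n) K,
      (ι ∘ y) ⬝ᵥ G.map ι *ᵥ (ι ∘ y) = ι (y ⬝ᵥ G *ᵥ y) := fun G =>
    (map_dotProduct_mulVec ι G y y).symm
  have hpolar : (ι ∘ y) ⬝ᵥ (G₁.map ι + (G₁.map ι)ᵀ) *ᵥ ((Polynomial.X : Polynomial K) • W) = 0 := by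
    have h : (G₁.map ι + (G₁.map ι)ᵀ) *ᵥ (ι ∘ y) = 0 := funext fun i => by
      have := congrArg ι (congrFun hy.1 i)
      rw [RingHom.map_mulVec] at this
      rw [← transpose_map, ← Matrix.map_add _ (map_add ι), this]
      simp
    have hs : (G₁.map ι + (G₁.map ι)ᵀ)ᵀ = G₁.map ι + (G₁.map ι)ᵀ := by
      rw [transpose_add, transpose_transpose, add_comm]
    rw [dotProduct_mulVec, ← mulVec_transpose, hs, h, zero_dotProduct]
  rw [add_mulVec, dotProduct_add, smul_mulVec, dotProduct_smul, hW, dotProduct_mulVec_add_self,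
    dotProduct_mulVec_add_self, hpolar, hι, hι, hy.2, dotProduct_mulVec_smul_self,
    dotProduct_mulVec_smul_self, mulVec_smul, dotProduct_smul] at hF
  have h1 := congrArg (Polynomial.coeff · 1) hF
  simp only [smul_eq_mul, map_zero, zero_add, add_zero, Polynomial.coeff_add, mul_add,
    Polynomial.coeff_X_mul] at h1
  simpa [ι, pow_two, mul_assoc, Polynomial.coeff_X_mul] using h1

end RadicalKernel

section Shape

open Module Matrix

variable {K : Type*} [Field K] {n : ℕ}

theorem exists_substMat_shape {G₁ G₂ : Matrix (Fin n) (Fin n) K} {r R : ℕ}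
    (hr : n - finrank K (quadRadical G₁) = r)
    (hR : n - finrank K (quadRadical G₁ ⊓ quadRadical G₂ : Submodule K (Fin n → K)) = R)
    (hrR : r < R) (hG₂ : ∀ y ∈ quadRadical G₁, y ⬝ᵥ G₂ *ᵥ y = 0) :
    ∃ T : Matrix (Fin n) (Fin n) K, IsUnit T.det ∧
      DependsOnlyOnFirst r (substMat T (quadPoly G₁)) ∧
      ∃ (q₂' : MvPolynomial (Fin n) K) (h₁ : r - 1 < n) (h₂ : R - 1 < n),
        DependsOnlyOnFirst (R - 1) q₂' ∧
        substMat T (quadPoly G₂) = q₂' + X (⟨r - 1, h₁⟩ : Fin n) * X (⟨R - 1, h₂⟩ : Fin n) := by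
  set W := quadRadical G₁
  set U := W ⊓ quadRadical G₂
  have hUW : U ≤ W := inf_le_left
  have hWn := W.finrank_le
  have hUn := U.finrank_le
  rw [finrank_fin_fun] at hWn hUn
  have hpolar : ∀ x ∈ W, ∀ y ∈ W, x ⬝ᵥ (G₂ + G₂ᵀ) *ᵥ y = 0 := fun x hx y hy => by
    have h := dotProduct_mulVec_add_self G₂ x y
    rwa [hG₂ _ hx, hG₂ _ hy, hG₂ _ (W.add_mem hx hy), zero_add, zero_add, eq_comm] at h
  obtain ⟨e, heW, heU⟩ : ∃ e ∈ W, e ∉ U := by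
    by_contra! h
    have := Submodule.finrank_mono (show W ≤ U from h)
    omega
  have he : (G₂ + G₂ᵀ) *ᵥ e ≠ 0 := fun h => heU ⟨heW, h, hG₂ e heW⟩
  let φ : (Fin n → K) →ₗ[K] K := dotProductBilin K K ((G₂ + G₂ᵀ) *ᵥ e)
  have hφ : ∀ x, φ x = x ⬝ᵥ (G₂ + G₂ᵀ) *ᵥ e := fun x =>
    dotProduct_comm ((G₂ + G₂ᵀ) *ᵥ e) x
  have hWφ : W ≤ LinearMap.ker φ := fun x hx => by
    rw [LinearMap.mem_ker, hφ, hpolar x hx e heW]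
  have hφ_lt : finrank K (LinearMap.ker φ) < n := by
    have h : LinearMap.ker φ < ⊤ := by
      rw [lt_top_iff_ne_top, Ne, LinearMap.ker_eq_top]
      intro h
      exact he (dotProduct_eq_zero _ fun y => LinearMap.congr_fun h y)
    simpa using Submodule.finrank_lt h.ne
  have hφ_ge : n - 1 ≤ finrank K (LinearMap.ker φ) := by
    have h := φ.finrank_range_add_finrank_ker
    have h' := (LinearMap.range φ).finrank_le
    rw [finrank_self] at h'
    rw [finrank_fin_fun] at h
    omega
  have hWlt := Submodule.finrank_mono hWφ
  have hspan : finrank K U + 1 ≤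
      finrank K (U ⊔ Submodule.span K {e} : Submodule K (Fin n → K)) := by
    apply Submodule.finrank_lt_finrank_of_lt
    rw [left_lt_sup]
    exact fun h => heU (h (Submodule.mem_span_singleton_self e))
  have hspanW : U ⊔ Submodule.span K {e} ≤ W :=
    sup_le hUW ((Submodule.span_singleton_le_iff_mem _ _).2 heW)
  obtain ⟨b, hb, hbW⟩ := exists_linearIndependent_mem_submodules
    (fun i : Fin n => if (i : ℕ) = 0 then ⊤ else if (i : ℕ) < r then LinearMap.ker φ else
      if (i : ℕ) < R - 1 then W else if (i : ℕ) = R - 1 then U ⊔ Submodule.span K {e} else U)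
    fun i => by
      by_cases h0 : (i : ℕ) = 0
      · rw [if_pos h0, finrank_top, finrank_fin_fun]
        omega
      by_cases h1 : (i : ℕ) < r
      · rw [if_neg h0, if_pos h1]
        omega
      by_cases h2 : (i : ℕ) < R - 1
      · rw [if_neg h0, if_neg h1, if_pos h2]
        omega
      by_cases h3 : (i : ℕ) = R - 1
      · rw [if_neg h0, if_neg h1, if_neg h2, if_pos h3]
        omega
      · rw [if_neg h0, if_neg h1, if_neg h2, if_neg h3]
        omega
  have h₁ : r - 1 < n := by omega
  have h₂ : R - 1 < n := by omega
  let o : Fin n := ⟨0, by omega⟩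
  let k : Fin n := ⟨r - 1, h₁⟩
  let l : Fin n := ⟨R - 1, h₂⟩
  have hbU : ∀ i : Fin n, R ≤ i → b i ∈ U := fun i hi => by
    have := hbW i
    rwa [if_neg (by omega), if_neg (by omega), if_neg (by omega), if_neg (by omega)] at this
  have hbl : b l ∈ U ⊔ Submodule.span K {e} := by
    have := hbW l
    rwa [if_neg (by simp [l]; omega), if_neg (by simp [l]; omega), if_neg (by simp [l]),
      if_pos rfl] at this
  have hbWr : ∀ i : Fin n, r ≤ i → b i ∈ W := fun i hi => by
    rcases lt_trichotomy (i : ℕ) (R - 1) with h | h | h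
    · have := hbW i
      rwa [if_neg (by omega), if_neg (by omega), if_pos h] at this
    · rw [show i = l from Fin.ext h]
      exact hspanW hbl
    · exact hUW (hbU i (by omega))
  have hbφ : ∀ i : Fin n, i ≠ o → φ (b i) = 0 := fun i hi => by
    by_cases h : r ≤ i
    · exact hWφ (hbWr i h)
    · have := hbW i
      rw [if_neg (fun h => hi (Fin.ext h)), if_pos (by omega)] at this
      exact this
  have hblU : b l ∉ U := fun h => by
    have := hb.sub_le_finrank (m := R - 1) (U := U) fun i hi => by
      rcases hi.eq_or_lt with h' | h'
      · rwa [show i = l from Fin.ext h'.symm]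
      · exact hbU i (by omega)
    omega
  have hbo : φ (b o) ≠ 0 := fun h => by
    have := hb.sub_le_finrank (m := 0) (U := LinearMap.ker φ) fun i _ => by
      by_cases hi : i = o
      · rw [hi]
        exact h
      · exact hbφ i hi
    omega
  obtain ⟨u, hu, w, hw, huw⟩ := Submodule.mem_sup.1 hbl
  obtain ⟨c, rfl⟩ := Submodule.mem_span_singleton.1 hw
  have hc : c ≠ 0 := by
    rintro rfl
    exact hblU (by simpa [← huw] using hu)
  have hSl : (G₂ + G₂ᵀ) *ᵥ b l = c • ((G₂ + G₂ᵀ) *ᵥ e) := by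
    rw [← huw, mulVec_add, hu.2.1, zero_add, mulVec_smul]
  let a : Kˣ := Units.mk0 (c * φ (b o))⁻¹ (inv_ne_zero (mul_ne_zero hc hbo))
  let b' : Fin n → Fin n → K := Function.update (1 : Fin n → Kˣ) k a • (b ∘ Equiv.swap o k)
  have hb' : LinearIndependent K b' := (hb.comp _ (Equiv.swap o k).injective).units_smul _
  have hb'k : b' k = (c * φ (b o))⁻¹ • b o := by
    simp [b', a, Units.smul_def]
  have hb'_of_le : ∀ i : Fin n, r ≤ i → b' i = b i := fun i hi => by
    have hik : i ≠ k := fun h => by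
      have := congrArg Fin.val h
      simp only [k] at this
      omega
    have hio : i ≠ o := fun h => by
      have := congrArg Fin.val h
      simp only [o] at this
      omega
    simp [b', hik, Equiv.swap_apply_of_ne_of_ne hio hik]
  have hb'φ : ∀ i, i ≠ k → φ (b' i) = 0 := fun i hi => by
    have : b' i = b (Equiv.swap o k i) := by simp [b', hi]
    rw [this]
    exact hbφ _ fun h => hi (by rw [Equiv.swap_apply_eq_iff] at h; simpa using h)
  have hdelta : ∀ i, b' i ⬝ᵥ (G₂ + G₂ᵀ) *ᵥ b' l = if i = k then 1 else 0 := fun i => by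
    rw [hb'_of_le l (by simp [l]; omega), hSl, dotProduct_smul, ← hφ]
    split_ifs with h
    · rw [h, hb'k, map_smul, smul_eq_mul, smul_eq_mul]
      field_simp
    · rw [hb'φ i h, smul_zero]
  let T : Matrix (Fin n) (Fin n) K := (Matrix.of b')ᵀ
  have hcol : ∀ i, T.col i = b' i := fun _ => rfl
  have hT : IsUnit T.det := by
    rw [← isUnit_iff_isUnit_det, ← linearIndependent_cols_iff_isUnit]
    exact hb'
  refine ⟨T, hT, (dependsOnlyOnFirst_substMat_quadPoly_iff hT G₁).2 fun i hi => ?_,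
    quadPoly (Tᵀ * G₂ * T - Matrix.single k l 1), h₁, h₂, ?_, ?_⟩
  · rw [hcol, hb'_of_le i hi]
    exact hbWr i hi
  · rw [dependsOnlyOnFirst_quadPoly_iff]
    intro i hi
    have hik : k ≠ i := fun h => by
      have := congrArg Fin.val h
      simp only [k] at this
      omega
    refine ⟨?_, fun j => ?_⟩
    · rw [Matrix.sub_apply, transpose_mul_mul_apply, hcol, hb'_of_le i (by omega),
        hG₂ _ (hbWr i (by omega))]
      simp [hik]
    · have h := congrFun (congrFun (add_transpose_congr T G₂) j) i
      rw [transpose_mul_mul_apply, hcol, hcol, Matrix.add_apply, transpose_apply] at h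
      rw [Matrix.add_apply, transpose_apply, Matrix.sub_apply, Matrix.sub_apply]
      have hij : (Matrix.single k l (1 : K)) i j = 0 := by simp [hik]
      rcases hi.eq_or_lt with h' | h'
      · obtain rfl : i = l := Fin.ext h'.symm
        rw [hdelta] at h
        have hji : (Matrix.single k l (1 : K)) j l = if j = k then 1 else 0 := by
          simp [Matrix.single_apply, eq_comm]
        rw [hij, hji, ← h]
        ring
      · have hji : (Matrix.single k l (1 : K)) j i = 0 := by
          have : l ≠ i := fun h => by
            have := congrArg Fin.val h
            simp only [l] at this
            omega
          simp [this]
        rw [hb'_of_le i (by omega), (hbU i (by omega)).2.1, dotProduct_zero] at h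
        rw [hij, hji, sub_zero, sub_zero, add_comm, h]
  · rw [substMat_quadPoly]
    have := quadPoly_add (Tᵀ * G₂ * T - Matrix.single k l 1) (Matrix.single k l 1)
    rw [sub_add_cancel, quadPoly_single, C_1, one_mul] at this
    exact this

end Shape

section Pencil

open Module Matrix

theorem Matrix.le_rank_of_submatrix_det_ne_zero {K m n : Type*} [Field K] [Fintype m] [Fintype n]
    {r : ℕ} {A : Matrix m n K} {f : Fin r → m} {g : Fin r → n} (h : (A.submatrix f g).det ≠ 0) :
    r ≤ A.rank := by
  have := A.rank_submatrix_le f g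
  rwa [rank_of_det_ne_zero h, Fintype.card_fin] at this

theorem Matrix.rank_map_ringHom {K L m n : Type*} [Field K] [Field L] [Fintype m] [Fintype n]
    (A : Matrix m n K) (σ : K →+* L) : (A.map σ).rank = A.rank := by
  have hdet : ∀ {r : ℕ} (f : Fin r → m) (g : Fin r → n),
      ((A.map σ).submatrix f g).det = σ (A.submatrix f g).det := fun f g => by
    rw [RingHom.map_det]
    rfl
  apply le_antisymm
  · obtain ⟨f, g, h⟩ := (A.map σ).exists_submatrix_det_ne_zero
    rw [hdet] at h
    exact le_rank_of_submatrix_det_ne_zero fun h0 => h (by rw [h0, map_zero])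
  · obtain ⟨f, g, h⟩ := A.exists_submatrix_det_ne_zero
    apply le_rank_of_submatrix_det_ne_zero (f := f) (g := g)
    rw [hdet]
    exact (map_ne_zero σ).2 h

theorem Matrix.rank_add_finrank_ker {K : Type*} [Field K] {n : ℕ} (S : Matrix (Fin n) (Fin n) K) :
    S.rank + finrank K (LinearMap.ker S.mulVecLin) = n := by
  have := S.mulVecLin.finrank_range_add_finrank_ker
  rwa [finrank_fin_fun] at this

theorem Matrix.finrank_ker_map {K L : Type*} [Field K] [Field L] (σ : K →+* L) {n : ℕ}
    (S : Matrix (Fin n) (Fin n) K) :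
    finrank L (LinearMap.ker (S.map σ).mulVecLin) = finrank K (LinearMap.ker S.mulVecLin) := by
  have h1 := (S.map σ).rank_add_finrank_ker
  have h2 := S.rank_add_finrank_ker
  rw [rank_map_ringHom] at h1
  omega

theorem Matrix.map_smul_add_smul {K L m n : Type*} [Field K] [Field L] (σ : K →+* L)
    (A B : Matrix m n K) (a b : K) :
    (a • A + b • B).map σ = σ a • A.map σ + σ b • B.map σ := by
  ext i j
  simp

theorem Matrix.exists_le_rank_smul_add {K L m n : Type*} [Field K] [Field L] [Fintype m]
    [Fintype n] (σ : K →+* L) (A B : Matrix m n K) (a b : L)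
    (hcard : ((a • A.map σ + b • B.map σ).rank : Cardinal) < Cardinal.mk K) :
    ∃ t : K, (a • A.map σ + b • B.map σ).rank ≤ (t • A + B).rank := by
  have hex := (a • A.map σ + b • B.map σ).exists_submatrix_det_ne_zero
  generalize (a • A.map σ + b • B.map σ).rank = r at hex hcard ⊢
  obtain ⟨f, g, hdet⟩ := hex
  let A' := A.submatrix f g
  let B' := B.submatrix f g
  let P : Polynomial K := ((Polynomial.X : Polynomial K) • A'.map Polynomial.C +
    B'.map Polynomial.C).det
  have heval : ∀ t, P.eval t = (t • A' + B').det := fun t => by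
    rw [← Polynomial.coe_evalRingHom, RingHom.map_det]
    congr 1
    ext i j
    simp [mul_comm t]
  have heval₂ : ∀ t, P.eval₂ σ t = (t • A'.map σ + B'.map σ).det := fun t => by
    rw [← Polynomial.coe_eval₂RingHom, RingHom.map_det]
    congr 1
    ext i j
    simp [mul_comm t]
  have hP : P ≠ 0 := by
    intro hP
    change (a • A'.map σ + b • B'.map σ).det ≠ 0 at hdet
    by_cases hb : b = 0
    · have hA : A'.det = 0 := by
        have := Polynomial.coeff_det_X_add_C_card A' B'
        rw [show ((Polynomial.X : Polynomial K) • A'.map Polynomial.C +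
          B'.map Polynomial.C).det = 0 from hP, Polynomial.coeff_zero] at this
        exact this.symm
      apply hdet
      have h0 : (A'.map σ).det = 0 := by
        rw [← map_zero σ, ← hA, RingHom.map_det]
        rfl
      rw [hb, zero_smul, add_zero, det_smul, h0, mul_zero]
    · apply hdet
      have h0 := heval₂ (a / b)
      rw [hP, Polynomial.eval₂_zero] at h0
      have : a • A'.map σ + b • B'.map σ = b • ((a / b) • A'.map σ + B'.map σ) := by
        rw [smul_add, smul_smul, mul_div_cancel₀ _ hb]
      rw [this, det_smul, ← h0, mul_zero]
  have hdeg : (P.natDegree : Cardinal) < Cardinal.mk K := by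
    refine lt_of_le_of_lt (Nat.cast_le.2 ?_) hcard
    exact (Polynomial.natDegree_det_X_add_C_le A' B').trans_eq (Fintype.card_fin _)
  obtain ⟨t, ht⟩ := P.exists_eval_ne_zero_of_natDegree_lt_card hP hdeg
  rw [heval] at ht
  exact ⟨t, le_rank_of_submatrix_det_ne_zero (f := f) (g := g) ht⟩

variable {F : Type*} [Field F] {n : ℕ}

theorem isGreatest_pencilRmax_quadPoly (G₁ G₂ : Matrix (Fin n) (Fin n) F) :
    IsGreatest {m | ∃ a b : AlgebraicClosure F, (a ≠ 0 ∨ b ≠ 0) ∧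
      m = n - finrank (AlgebraicClosure F)
        (quadRadical (a • G₁.map (algebraMap F (AlgebraicClosure F)) +
          b • G₂.map (algebraMap F (AlgebraicClosure F))))}
      (pencilRmax (quadPoly G₁) (quadPoly G₂)) := by
  simp only [pencilRmax, map_quadPoly, ← quadPoly_smul, ← quadPoly_add, qRank_quadPoly]
  have hbdd : BddAbove {m | ∃ a b : AlgebraicClosure F, (a ≠ 0 ∨ b ≠ 0) ∧
      m = n - finrank (AlgebraicClosure F)
        (quadRadical (a • G₁.map (algebraMap F (AlgebraicClosure F)) +
          b • G₂.map (algebraMap F (AlgebraicClosure F))))} := by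
    refine ⟨n, ?_⟩
    rintro m ⟨a, b, -, rfl⟩
    exact Nat.sub_le _ _
  exact ⟨Nat.sSup_mem ⟨_, 1, 0, Or.inl one_ne_zero, rfl⟩ hbdd, fun m hm => le_csSup hbdd hm⟩

theorem mem_quadRadical_map_iff {K L : Type*} [Field K] [Field L] (σ : K →+* L)
    {G : Matrix (Fin n) (Fin n) K} {x : Fin n → K} :
    σ ∘ x ∈ quadRadical (G.map σ) ↔ x ∈ quadRadical G := by
  have h : (G.map σ + (G.map σ)ᵀ) *ᵥ (σ ∘ x) = σ ∘ ((G + Gᵀ) *ᵥ x) := by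
    funext i
    rw [Function.comp_apply, RingHom.map_mulVec, Matrix.map_add _ (map_add σ), transpose_map]
  rw [mem_quadRadical, mem_quadRadical, ← map_dotProduct_mulVec, h, _root_.map_eq_zero]
  refine and_congr_left fun _ => ⟨fun h => funext fun i => σ.injective ?_, fun h => ?_⟩
  · simpa using congrFun h i
  · rw [h]
    funext i
    simp

theorem map_add_transpose {K L : Type*} [Field K] [Field L] (σ : K →+* L)
    (G : Matrix (Fin n) (Fin n) K) : G.map σ + (G.map σ)ᵀ = (G + Gᵀ).map σ := by
  rw [Matrix.map_add _ (map_add σ), transpose_map]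

theorem exists_finrank_quadRadical_smul_add (G₁ G₂ : Matrix (Fin n) (Fin n) F) {r : ℕ}
    (hr : r = pencilRmax (quadPoly G₁) (quadPoly G₂)) (hcard : (r : Cardinal) < Cardinal.mk F)
    (h : (2 : F) ≠ 0 ∨ Even r) :
    ∃ t : F, n - finrank F (quadRadical (t • G₁ + G₂)) = r := by
  let σ := algebraMap F (AlgebraicClosure F)
  obtain ⟨⟨a, b, -, hab⟩, hmax⟩ := isGreatest_pencilRmax_quadPoly G₁ G₂
  rw [← hr] at hab hmax
  have hker := quadRadical_eq_ker (a • G₁.map σ + b • G₂.map σ) <| h.imp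
    (fun h => by rw [← map_ofNat σ 2]; exact (map_ne_zero σ).2 h)
    (fun h => ⟨hab ▸ h, fun x => IsAlgClosed.exists_pow_nat_eq x two_pos⟩)
  have hS : a • G₁.map σ + b • G₂.map σ + (a • G₁.map σ + b • G₂.map σ)ᵀ =
      a • (G₁ + G₁ᵀ).map σ + b • (G₂ + G₂ᵀ).map σ := by
    rw [← map_add_transpose, ← map_add_transpose]
    simp only [transpose_add, transpose_smul, smul_add]
    abel
  rw [hS] at hker
  have hrank := (a • (G₁ + G₁ᵀ).map σ + b • (G₂ + G₂ᵀ).map σ).rank_add_finrank_ker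
  rw [hker] at hab
  have hrank' : (a • (G₁ + G₁ᵀ).map σ + b • (G₂ + G₂ᵀ).map σ).rank = r := by omega
  obtain ⟨t, ht⟩ := Matrix.exists_le_rank_smul_add σ (G₁ + G₁ᵀ) (G₂ + G₂ᵀ) a b (by rwa [hrank'])
  rw [hrank'] at ht
  have hSt : t • (G₁ + G₁ᵀ) + (G₂ + G₂ᵀ) = t • G₁ + G₂ + (t • G₁ + G₂)ᵀ := by
    simp only [transpose_add, transpose_smul, smul_add]
    abel
  rw [hSt] at ht
  have hle : n - finrank (AlgebraicClosure F) (quadRadical ((t • G₁ + G₂).map σ)) ≤ r := by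
    refine hmax ⟨σ t, 1, Or.inr one_ne_zero, ?_⟩
    rw [Matrix.map_add _ (map_add σ), one_smul, Matrix.map_smul' σ t G₁ (map_mul σ)]
  have hkt := (t • G₁ + G₂ + (t • G₁ + G₂)ᵀ).rank_add_finrank_ker
  have hkσ := Matrix.finrank_ker_map σ (t • G₁ + G₂ + (t • G₁ + G₂)ᵀ)
  rw [← map_add_transpose] at hkσ
  have hmono := Submodule.finrank_mono (quadRadical_le_ker ((t • G₁ + G₂).map σ))
  have heq := Submodule.eq_of_le_of_finrank_eq (quadRadical_le_ker ((t • G₁ + G₂).map σ)) (by omega)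
  have hF : quadRadical (t • G₁ + G₂) = LinearMap.ker (t • G₁ + G₂ + (t • G₁ + G₂)ᵀ).mulVecLin := by
    refine le_antisymm (quadRadical_le_ker _) fun x hx => ?_
    rw [← mem_quadRadical_map_iff σ, heq, map_add_transpose]
    rw [LinearMap.mem_ker, mulVecLin_apply] at hx ⊢
    funext i
    have := congrArg σ (congrFun hx i)
    rw [RingHom.map_mulVec] at this
    rw [this]
    simp
  refine ⟨t, ?_⟩
  rw [hF]
  rw [heq] at hle
  omega

theorem dotProduct_mulVec_eq_zero_of_mem_quadRadical {G₁ G₂ : Matrix (Fin n) (Fin n) F} {r : ℕ}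
    (hr : n - finrank F (quadRadical G₁) = r)
    (hker : quadRadical G₁ = LinearMap.ker (G₁ + G₁ᵀ).mulVecLin)
    (hmax : ∀ s : AlgebraicClosure F, n - finrank (AlgebraicClosure F)
      (quadRadical (G₁.map (algebraMap F (AlgebraicClosure F)) +
        s • G₂.map (algebraMap F (AlgebraicClosure F)))) ≤ r)
    {y : Fin n → F} (hy : y ∈ quadRadical G₁) : y ⬝ᵥ G₂ *ᵥ y = 0 := by
  let σ := algebraMap F (AlgebraicClosure F)
  have h := dotProduct_mulVec_eq_zero_of_finrank_le (G₁ := G₁.map σ) (G₂ := G₂.map σ) (fun s => ?_)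
    ((mem_quadRadical_map_iff σ).2 hy)
  · apply σ.injective
    rw [map_zero, ← h, map_dotProduct_mulVec]
  · rw [map_add_transpose, Matrix.finrank_ker_map, ← hker]
    have h1 := (quadRadical G₁).finrank_le
    have h2 := hmax s
    rw [finrank_fin_fun] at h1
    change _ ≤ finrank _ (quadRadical (G₁.map (algebraMap F (AlgebraicClosure F)) +
        s • G₂.map (algebraMap F (AlgebraicClosure F))))
    omega

theorem quadRadical_inf_quadRadical_le {K : Type*} [Field K] (G₁ G₂ : Matrix (Fin n) (Fin n) K)
    (a b : K) : quadRadical G₁ ⊓ quadRadical G₂ ≤ quadRadical (a • G₁ + b • G₂) := by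
  rintro x ⟨⟨h₁, h₁'⟩, h₂, h₂'⟩
  constructor
  · have : a • G₁ + b • G₂ + (a • G₁ + b • G₂)ᵀ = a • (G₁ + G₁ᵀ) + b • (G₂ + G₂ᵀ) := by
      simp only [transpose_add, transpose_smul, smul_add]
      abel
    rw [this, add_mulVec, smul_mulVec, smul_mulVec, h₁, h₂, smul_zero, smul_zero, add_zero]
  · rw [add_mulVec, smul_mulVec, smul_mulVec, dotProduct_add, dotProduct_smul, dotProduct_smul,
      h₁', h₂', smul_zero, smul_zero, add_zero]

theorem quadRadical_inf_quadRadical {K : Type*} [Field K] {G₁ G₂ : Matrix (Fin n) (Fin n) K}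
    {a b c d : K} (h : a * d - b * c ≠ 0) :
    quadRadical (a • G₁ + b • G₂) ⊓ quadRadical (c • G₁ + d • G₂) =
      quadRadical G₁ ⊓ quadRadical G₂ := by
  refine le_antisymm (le_inf ?_ ?_) (le_inf (quadRadical_inf_quadRadical_le _ _ _ _)
    (quadRadical_inf_quadRadical_le _ _ _ _))
  · convert quadRadical_inf_quadRadical_le (a • G₁ + b • G₂) (c • G₁ + d • G₂)
      (d / (a * d - b * c)) (-b / (a * d - b * c)) using 2
    ext i j
    simp only [Matrix.add_apply, Matrix.smul_apply, smul_eq_mul]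
    linear_combination -G₁ i j * inv_mul_cancel₀ h
  · convert quadRadical_inf_quadRadical_le (a • G₁ + b • G₂) (c • G₁ + d • G₂)
      (-c / (a * d - b * c)) (a / (a * d - b * c)) using 2
    ext i j
    simp only [Matrix.add_apply, Matrix.smul_apply, smul_eq_mul]
    linear_combination -G₂ i j * inv_mul_cancel₀ h

end Pencil

/-- Lemma `lemshape1`: let `P = <p₁,p₂>` be a pencil of quadratic forms in `n`
variables over a field `F` with `#F ≥ n`, write `r = r(P)`, `R = R(P)` and suppose `r < R`.
Assume either that `char F ≠ 2`, or that `r` is even and `F` is the residue field of the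
completion of a number field at a non-archimedean place.  Then a basis `q₁, q₂` of `P` can be
chosen with `rank q₁ = r`, and for any such basis an invertible change of variables over `F` puts
`q₁` in the shape `q₁'(X_1,…,X_r)` and `q₂` in the shape `q₂'(X_1,…,X_{R-1}) + X_rX_R`.
(The auxiliary number field `k` and place `v` are universally quantified so that the residue
field alternative can be stated; in the case `char F ≠ 2` they play no role.) -/
theorem stmt_10 {F : Type*} [Field F] {n : ℕ}
    (k : Type*) [Field k] [NumberField k] (v : HeightOneSpectrum (𝓞 k))
    (hcardF : (n : Cardinal) ≤ Cardinal.mk F)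
    (p₁ p₂ : MvPolynomial (Fin n) F)
    (hp₁ : p₁.IsHomogeneous 2) (hp₂ : p₂.IsHomogeneous 2)
    (hindep : LinearIndependent F ![p₁, p₂])
    (r R : ℕ) (hrdef : r = pencilRmax p₁ p₂) (hRdef : R = pencilR p₁ p₂)
    (hrR : r < R)
    (hcase : ringChar F ≠ 2 ∨ (Even r ∧
      Nonempty (F ≃+* IsLocalRing.ResidueField (v.adicCompletionIntegers k)))) :
    (∃ a b : F, qRank (MvPolynomial.C a * p₁ + MvPolynomial.C b * p₂) = r ∧
      ∃ c d : F, a * d - b * c ≠ 0) ∧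
    (∀ a b c d : F, a * d - b * c ≠ 0 →
      qRank (MvPolynomial.C a * p₁ + MvPolynomial.C b * p₂) = r →
      ∃ T : Matrix (Fin n) (Fin n) F, IsUnit T.det ∧
        DependsOnlyOnFirst r (substMat T (MvPolynomial.C a * p₁ + MvPolynomial.C b * p₂)) ∧
        ∃ (q₂' : MvPolynomial (Fin n) F) (h₁ : r - 1 < n) (h₂ : R - 1 < n),
          DependsOnlyOnFirst (R - 1) q₂' ∧
          substMat T (MvPolynomial.C c * p₁ + MvPolynomial.C d * p₂) =
            q₂' + MvPolynomial.X (⟨r - 1, h₁⟩ : Fin n) * MvPolynomial.X (⟨R - 1, h₂⟩ : Fin n)) := by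
  obtain ⟨G₁, rfl⟩ := exists_eq_quadPoly hp₁
  obtain ⟨G₂, rfl⟩ := exists_eq_quadPoly hp₂
  rw [pencilR_quadPoly] at hRdef
  have hcase' : (2 : F) ≠ 0 ∨ Even r ∧ ∀ x : F, ∃ y, y ^ 2 = x := by
    by_cases h2 : (2 : F) = 0
    · have hchar : CharP F 2 := CharTwo.of_one_ne_zero_of_two_eq_zero one_ne_zero h2
      obtain ⟨heven, ⟨ε⟩⟩ := hcase.resolve_left fun h => h (ringChar.eq F 2)
      have := finite_residueField_adicCompletionIntegers k v
      have : Finite F := Finite.of_equiv _ ε.symm.toEquiv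
      exact Or.inr ⟨heven, (bijective_frobenius F 2).2⟩
    · exact Or.inl h2
  simp only [← quadPoly_smul, ← quadPoly_add, qRank_quadPoly]
  refine ⟨?_, fun a b c d hdet hr => ?_⟩
  · have hcard : (r : Cardinal) < Cardinal.mk F :=
      lt_of_lt_of_le (Nat.cast_lt.2 (by omega)) hcardF
    obtain ⟨t, ht⟩ := exists_finrank_quadRadical_smul_add G₁ G₂ hrdef hcard
      (hcase'.imp_right And.left)
    exact ⟨t, 1, by rwa [one_smul], 1, 0, by simp⟩
  · have hker := quadRadical_eq_ker (a • G₁ + b • G₂) (by rwa [hr])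
    refine exists_substMat_shape hr ?_ hrR fun y hy =>
      dotProduct_mulVec_eq_zero_of_mem_quadRadical hr hker (fun s => ?_) hy
    · rw [quadRadical_inf_quadRadical hdet, hRdef]
    · rw [hrdef]
      refine (isGreatest_pencilRmax_quadPoly G₁ G₂).2
        ⟨algebraMap F _ a + s * algebraMap F _ c, algebraMap F _ b + s * algebraMap F _ d, ?_, ?_⟩
      · by_contra! h
        apply hdet
        apply (algebraMap F (AlgebraicClosure F)).injective
        simp only [map_sub, map_mul, map_zero]
        linear_combination h.1 * algebraMap F (AlgebraicClosure F) d -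
          h.2 * algebraMap F (AlgebraicClosure F) c
      · rw [Matrix.map_smul_add_smul, Matrix.map_smul_add_smul, add_smul, add_smul, mul_smul,
          mul_smul, smul_add, add_add_add_comm]
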